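/- arXiv:2501.06279 — 2 statements merged into one kernel-verified Lean document; each statement's English description precedes it below -/
import Mathlib

section
/- For every objective j ∈ {1,…,m}, there exists a portfolio q that is cost-efficient in the non-informative weight set S⁰ and attains the maximum performance on objective j, i.e., E_j(q) ≥ E_j(q') for every portfolio q' ∈ Q. -/
open Finset

noncomputable section

/-- The non-informative weight set: the standard simplex in `ℝ^m`. -/
def S0 (m : ℕ) : Set (Fin m → ℝ) :=
  {w | (∀ j, 0 ≤ w j) ∧ ∑ j, w j = 1}

/-- Expected overall utility `U(q,w) = ∑ j, w_j E_j(q)`. -/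
def U {P : Type*} {m : ℕ} (E : P → Fin m → ℝ) (q : P) (w : Fin m → ℝ) : ℝ :=
  ∑ j, w j * E q j

/-- `Dominates E S q2 q1` : portfolio `q2` dominates portfolio `q1` in the weight set `S`. -/
def Dominates {P : Type*} {m : ℕ} (E : P → Fin m → ℝ) (S : Set (Fin m → ℝ))
    (q2 q1 : P) : Prop :=
  (∀ w ∈ S, U E q1 w ≤ U E q2 w) ∧ ∃ w ∈ S, U E q1 w < U E q2 w

/-- `EquivIn E S q1 q2` : portfolios `q1` and `q2` are `S`-equivalent. -/
def EquivIn {P : Type*} {m : ℕ} (E : P → Fin m → ℝ) (S : Set (Fin m → ℝ))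
    (q1 q2 : P) : Prop :=
  ∀ w ∈ S, U E q1 w = U E q2 w

/-- `CostEffWrt E c S q1 q2` : portfolio `q1` is cost-efficient with respect to `q2` in `S`. -/
def CostEffWrt {P : Type*} {m : ℕ} (E : P → Fin m → ℝ) (c : P → ℝ)
    (S : Set (Fin m → ℝ)) (q1 q2 : P) : Prop :=
  (Dominates E S q1 q2 ∧ c q1 ≤ c q2) ∨ (EquivIn E S q1 q2 ∧ c q1 < c q2)

/-- `CostEfficient E c Q S q` : portfolio `q` is cost-efficient in `S`
(no portfolio in `Q` is cost-efficient with respect to `q` in `S`). -/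
def CostEfficient {P : Type*} {m : ℕ} (E : P → Fin m → ℝ) (c : P → ℝ)
    (Q : Finset P) (S : Set (Fin m → ℝ)) (q : P) : Prop :=
  ¬ ∃ q' ∈ Q, CostEffWrt E c S q' q

/-- The utility at a vertex of the simplex is the corresponding objective. -/
lemma U_single {P : Type*} {m : ℕ} (E : P → Fin m → ℝ) (q : P) (i : Fin m) :
    U E q (Pi.single i 1) = E q i := by
  simp [U, Pi.single_apply]

lemma single_mem_S0 {m : ℕ} (i : Fin m) : Pi.single i 1 ∈ S0 m := by
  refine ⟨fun k => ?_, by simp⟩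
  by_cases h : k = i <;> simp [h]

lemma le_of_forall_U_le {P : Type*} {m : ℕ} {E : P → Fin m → ℝ} {q₁ q₂ : P}
    (h : ∀ w ∈ S0 m, U E q₁ w ≤ U E q₂ w) (i : Fin m) : E q₁ i ≤ E q₂ i := by
  simpa only [U_single] using h _ (single_mem_S0 i)

lemma Dominates.sum_lt {P : Type*} {m : ℕ} {E : P → Fin m → ℝ} {q₁ q₂ : P}
    (h : Dominates E (S0 m) q₂ q₁) : ∑ i, E q₁ i < ∑ i, E q₂ i := by
  obtain ⟨hle, w, hw, hlt⟩ := h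
  obtain ⟨i, -, hi⟩ := Finset.exists_lt_of_sum_lt hlt
  exact Finset.sum_lt_sum (fun k _ => le_of_forall_U_le hle k)
    ⟨i, Finset.mem_univ i, lt_of_mul_lt_mul_left hi (hw.1 i)⟩

/-- Cost-efficiency with respect to a portfolio strictly increases total utility net of cost. -/
lemma CostEffWrt.le_and_net_lt {P : Type*} {m : ℕ} {E : P → Fin m → ℝ} {c : P → ℝ} {q₁ q₂ : P}
    (h : CostEffWrt E c (S0 m) q₁ q₂) :
    (∀ i, E q₂ i ≤ E q₁ i) ∧ ∑ i, E q₂ i - c q₂ < ∑ i, E q₁ i - c q₁ := by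
  rcases h with ⟨hd, hc⟩ | ⟨he, hc⟩
  · exact ⟨le_of_forall_U_le hd.1, by linarith [hd.sum_lt]⟩
  · have hle : ∀ i, E q₂ i ≤ E q₁ i := le_of_forall_U_le fun w hw => (he w hw).ge
    exact ⟨hle, by linarith [Finset.sum_le_sum fun i (_ : i ∈ Finset.univ) => hle i]⟩

/-- For every objective `j`, there is a portfolio `q ∈ Q` that is cost-efficient in the
non-informative set `S⁰` and attains the maximum performance on objective `j`. -/
theorem stmt1 {P : Type*} {m : ℕ} (Q : Finset P) (hQ : Q.Nonempty)
    (c : P → ℝ) (E : P → Fin m → ℝ) (j : Fin m) :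
    ∃ q ∈ Q, CostEfficient E c Q (S0 m) q ∧ ∀ q' ∈ Q, E q' j ≤ E q j := by
  classical
  obtain ⟨p, hpQ, hp⟩ := Q.exists_max_image (fun q => E q j) hQ
  obtain ⟨q, hq, hmax⟩ := (Q.filter fun q => E p j ≤ E q j).exists_max_image
    (fun q => ∑ i, E q i - c q) ⟨p, by simp [hpQ]⟩
  rw [Finset.mem_filter] at hq
  refine ⟨q, hq.1, ?_, fun q' hq' => (hp q' hq').trans hq.2⟩
  rintro ⟨q', hq', hce⟩
  obtain ⟨hle, hlt⟩ := hce.le_and_net_lt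
  exact (hmax q' (Finset.mem_filter.2 ⟨hq', hq.2.trans (hle j)⟩)).not_gt hlt
end
end

section
/- Let q ∈ {0,1}^h, l ∈ {0,1,…,h}, costs c_1,…,c_h ≥ 0, and budget r ∈ ℝ, and define the extended portfolio q^a by q^a_y = q_y for y ≤ l and q^a_y = 1 for y > l. Suppose the failure-probability map is antitone in the portfolio (q ≤ q' componentwise implies p_k(q') ≤ p_k(q) for every node k) and the utility function u : {0,1}^n → ℝ is coherent. Then for every feasible extension q' of q (i.e., q'_y = q_y for all y ≤ l and ∑_{y=1}^h c_y q'_y ≤ r), one has E_{p(q')}[u] ≤ E_{p(q^a)}[u]; hence the upper bound obtained by maximizing expected utility over feasible extensions is always lower than or equal to the upper bound provided by q^a. -/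
open Finset

noncomputable section

/-- Probability of network state `x ∈ {0,1}^n` under independent node failure
probabilities `p` : `P_p(x) = ∏ k, (x_k (1 - p_k) + (1 - x_k) p_k)`. -/
def stateProb {n : ℕ} (p : Fin n → ℝ) (x : Fin n → Bool) : ℝ :=
  ∏ k, if x k then (1 - p k) else p k

/-- Expected value of a utility function `u` on network states under failure
probabilities `p`. -/
def expUtil {n : ℕ} (p : Fin n → ℝ) (u : (Fin n → Bool) → ℝ) : ℝ :=
  ∑ x : Fin n → Bool, stateProb p x * u x

theorem stateProb_nonneg {n : ℕ} {p : Fin n → ℝ} (hp : ∀ k, p k ∈ Set.Icc (0 : ℝ) 1)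
    (x : Fin n → Bool) : 0 ≤ stateProb p x := by
  refine Finset.prod_nonneg fun k _ => ?_
  have := hp k
  split_ifs
  · exact sub_nonneg.2 this.2
  · exact this.1

theorem expUtil_mono_right {n : ℕ} {p : Fin n → ℝ} (hp : ∀ k, p k ∈ Set.Icc (0 : ℝ) 1)
    {u v : (Fin n → Bool) → ℝ} (huv : ∀ x, u x ≤ v x) : expUtil p u ≤ expUtil p v :=
  Finset.sum_le_sum fun x _ => mul_le_mul_of_nonneg_left (huv x) (stateProb_nonneg hp x)

/-- Conditioning the expected utility on the state of the first node. -/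
theorem expUtil_succ {n : ℕ} (p : Fin (n + 1) → ℝ) (u : (Fin (n + 1) → Bool) → ℝ) :
    expUtil p u =
      (1 - p 0) * expUtil (fun k => p k.succ) (fun x => u (Fin.cons true x)) +
        p 0 * expUtil (fun k => p k.succ) (fun x => u (Fin.cons false x)) := by
  unfold expUtil
  rw [← (Fin.consEquiv (fun _ : Fin (n + 1) => Bool)).sum_comp, Fintype.sum_prod_type,
    Fintype.sum_bool, Finset.mul_sum, Finset.mul_sum]
  simp [stateProb, Fin.consEquiv, Fin.prod_univ_succ, mul_assoc]

/-- The expected value of a coherent utility function is antitone in the failure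
probabilities. -/
theorem expUtil_anti_left {n : ℕ} {p p' : Fin n → ℝ}
    (hp : ∀ k, p k ∈ Set.Icc (0 : ℝ) 1) (hp' : ∀ k, p' k ∈ Set.Icc (0 : ℝ) 1)
    (hle : ∀ k, p' k ≤ p k) {u : (Fin n → Bool) → ℝ}
    (hu : ∀ x y : Fin n → Bool, (∀ k, x k ≤ y k) → u x ≤ u y) :
    expUtil p u ≤ expUtil p' u := by
  induction n with
  | zero => simp [expUtil, stateProb]
  | succ n ih =>
    have step (b : Bool) :
        expUtil (fun k => p k.succ) (fun x => u (Fin.cons b x)) ≤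
          expUtil (fun k => p' k.succ) (fun x => u (Fin.cons b x)) :=
      ih (fun k => hp _) (fun k => hp' _) (fun k => hle _) fun x y hxy =>
        hu _ _ (Fin.cases le_rfl hxy)
    have first : expUtil (fun k => p' k.succ) (fun x => u (Fin.cons false x)) ≤
        expUtil (fun k => p' k.succ) (fun x => u (Fin.cons true x)) :=
      expUtil_mono_right (fun k => hp' _) fun x =>
        hu _ _ (Fin.cases (Bool.false_le true) fun k => le_rfl)
    rw [expUtil_succ, expUtil_succ]
    linarith [mul_le_mul_of_nonneg_left (step true) (sub_nonneg.2 (hp 0).2),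
      mul_le_mul_of_nonneg_left (step false) (hp 0).1,
      mul_le_mul_of_nonneg_left first (sub_nonneg.2 (hle 0))]

/-- For every *feasible* extension `q'` of `q` (agreeing with `q` on the first `l`
actions and respecting the budget `r`), the expected utility is at most that of the
extended portfolio `q^a`; hence the optimal value over feasible extensions is bounded
above by the bound provided by `q^a`. -/
theorem stmt8 {n h : ℕ}
    (pmap : (Fin h → Bool) → Fin n → ℝ)
    (hrange : ∀ q k, pmap q k ∈ Set.Icc (0 : ℝ) 1)
    (hanti : ∀ q q' : Fin h → Bool, (∀ y, q y ≤ q' y) → ∀ k, pmap q' k ≤ pmap q k)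
    (u : (Fin n → Bool) → ℝ)
    (hu : ∀ x y : Fin n → Bool, (∀ k, x k ≤ y k) → u x ≤ u y)
    (q : Fin h → Bool) (l : ℕ) (hl : l ≤ h)
    (c : Fin h → ℝ) (hc : ∀ y, 0 ≤ c y) (r : ℝ)
    (qa : Fin h → Bool) (hqa : ∀ y : Fin h, qa y = if (y : ℕ) < l then q y else true)
    (q' : Fin h → Bool) (hq' : ∀ y : Fin h, (y : ℕ) < l → q' y = q y)
    (hfeas : ∑ y, (if q' y then c y else 0) ≤ r) :
    expUtil (pmap q') u ≤ expUtil (pmap qa) u := by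
  refine expUtil_anti_left (hrange q') (hrange qa) (hanti q' qa fun y => ?_) hu
  rw [hqa]
  split_ifs with hy
  · exact (hq' y hy).le
  · exact Bool.le_true _
end
end
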